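/- Let n, m be positive integers and let lb, ub : Fin m → ℤ. Let F be the set of all functions g : Fin n → Fin m such that for every j, lb j ≤ |{i : g i = j}| ≤ ub j. Fix j₀ : Fin m and let S = { k : ℕ | ∃ g ∈ F, |{i : g i = j₀}| = k }. Then S is an interval of integers: if a, b ∈ S and k is a natural number with a ≤ k ≤ b, then k ∈ S. -/

import Mathlib

open Finset

/-- The set of achievable counts of a fixed bin, over all feasible bin
assignments, has no holes: it is an interval of integers. -/
theorem bin_counts_achievable_counts_interval
    (n m : ℕ) (hn : 0 < n) (hm : 0 < m) (lb ub : Fin m → ℤ)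
    (F : Set (Fin n → Fin m))
    (hF : F = {g | ∀ j, lb j ≤ ((Finset.univ.filter fun i => g i = j).card : ℤ) ∧
      ((Finset.univ.filter fun i => g i = j).card : ℤ) ≤ ub j})
    (j₀ : Fin m) (S : Set ℕ)
    (hS : S = {k | ∃ g ∈ F, (Finset.univ.filter fun i => g i = j₀).card = k}) :
    ∀ a ∈ S, ∀ b ∈ S, ∀ k : ℕ, a ≤ k → k ≤ b → k ∈ S := by
  subst hF hS
  rintro a ha b ⟨h, hh, hb⟩ k hak
  induction k, hak using Nat.le_induction with
  | base => intro _; exact ha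
  | succ k hak ih =>
    intro hkb
    obtain ⟨g, hg, hk⟩ := ih (by omega)
    have hsum : ∀ f : Fin n → Fin m,
        ∑ j, (Finset.univ.filter fun i => f i = j).card = n := by
      intro f
      have := Finset.card_eq_sum_card_fiberwise (f := f) (s := Finset.univ)
        (t := Finset.univ) (fun _ _ => by simp)
      simpa using this.symm
    obtain ⟨j, hj⟩ : ∃ j, (Finset.univ.filter fun i => h i = j).card
        < (Finset.univ.filter fun i => g i = j).card := by
      by_contra! hcon
      have := Finset.sum_lt_sum (fun j (_ : j ∈ Finset.univ) => hcon j)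
        ⟨j₀, Finset.mem_univ _, by omega⟩
      rw [hsum, hsum] at this
      omega
    have hjj : j ≠ j₀ := by
      rintro rfl
      omega
    obtain ⟨i, hi⟩ := Finset.card_pos.mp (lt_of_le_of_lt (Nat.zero_le _) hj)
    have hi' : g i = j := by simpa using hi
    have e0 : (Finset.univ.filter fun x => Function.update g i j₀ x = j₀)
        = insert i (Finset.univ.filter fun x => g x = j₀) := by
      ext x
      by_cases hx : x = i <;> simp [Function.update_apply, hx]
    have e1 : (Finset.univ.filter fun x => Function.update g i j₀ x = j)
        = (Finset.univ.filter fun x => g x = j).erase i := by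
      ext x
      by_cases hx : x = i <;> simp [Function.update_apply, hx, hjj.symm]
    have c0 : (Finset.univ.filter fun x => Function.update g i j₀ x = j₀).card = k + 1 := by
      rw [e0, Finset.card_insert_of_notMem (by simp [hi', hjj]), hk]
    have c1 := Finset.card_erase_of_mem hi
    rw [← e1] at c1
    refine ⟨Function.update g i j₀, fun j' => ?_, c0⟩
    by_cases h0 : j' = j₀
    · subst h0
      have h1 := hg j'
      have h2 := hh j'
      rw [c0]
      rw [hk] at h1
      rw [hb] at h2
      omega
    by_cases h1 : j' = j
    · rw [h1]
      have h1 := hg j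
      have h2 := hh j
      omega
    · have e2 : (Finset.univ.filter fun x => Function.update g i j₀ x = j')
          = (Finset.univ.filter fun x => g x = j') := by
        ext x
        by_cases hx : x = i
        · simp [hx, hi', Ne.symm h0, Ne.symm h1]
        · simp [Function.update_apply, hx]
      rw [e2]
      exact hg j'
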